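/- arXiv:cs/0011009 — 5 statements merged into one kernel-verified Lean document; each statement's English description precedes it below -/
import Mathlib

section
/- Let G be a finite simple graph on n vertices and let k be a nonnegative integer. Then the number of maximal independent sets I of G with |I| ≤ k is at most 3^(4k−n) · 4^(n−3k), where the bound is interpreted as a real number (the integer exponents 4k−n and n−3k may be negative). -/
/-- `I` is an independent set of `G`: its vertices are pairwise non-adjacent. -/
def IsIndep {V : Type*} (G : SimpleGraph V) (I : Finset V) : Prop :=
  (↑I : Set V).Pairwise fun a b => ¬ G.Adj a b

/-- `I` is a maximal independent set of the subgraph of `G` induced by `A`: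
`I ⊆ A`, `I` is independent, and `I` is not properly contained in any
independent set contained in `A`. -/
def IsMaxIndepOn {V : Type*} (G : SimpleGraph V) (A : Set V) (I : Finset V) : Prop :=
  ↑I ⊆ A ∧ IsIndep G I ∧
    ∀ J : Finset V, ↑J ⊆ A → IsIndep G J → I ⊆ J → I = J

open Classical in
/-- Members of `S` outside the closed neighbourhood of `v`. -/
noncomputable def restG {V : Type*} (G : SimpleGraph V) (v : V) (S : Finset V) : Finset V :=
  S.filter fun u => ¬ (u = v ∨ G.Adj v u)

open Classical in
/-- Closed neighbourhood of `v` in `S`. -/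
noncomputable def closedN {V : Type*} (G : SimpleGraph V) (v : V) (S : Finset V) : Finset V :=
  S.filter fun u => u = v ∨ G.Adj v u

open Classical in
/-- Maximal independent sets of `G[S]` of size at most `k`. -/
noncomputable def misF {V : Type*} (G : SimpleGraph V) (S : Finset V) (k : ℕ) :
    Finset (Finset V) :=
  S.powerset.filter fun I => (∀ a ∈ I, ∀ b ∈ I, ¬ G.Adj a b) ∧
    (∀ v ∈ S, v ∉ I → ∃ u ∈ I, G.Adj v u) ∧ I.card ≤ k

theorem mem_misF {V : Type*} {G : SimpleGraph V} {S : Finset V} {k : ℕ} {I : Finset V} :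
    I ∈ misF G S k ↔ I ⊆ S ∧ (∀ a ∈ I, ∀ b ∈ I, ¬ G.Adj a b) ∧
    (∀ v ∈ S, v ∉ I → ∃ u ∈ I, G.Adj v u) ∧ I.card ≤ k := by
  simp [misF]

theorem card_rest_add {V : Type*} (G : SimpleGraph V) (v : V) (S : Finset V) :
    (closedN G v S).card + (restG G v S).card = S.card := by
  classical
  exact Finset.card_filter_add_card_filter_not _

open Classical in
theorem mis_in {V : Type*} (G : SimpleGraph V) (v : V) (S : Finset V) (k : ℕ) :
    ((misF G S (k+1)).filter fun I => v ∈ I).card ≤ (misF G (restG G v S) k).card := by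
  apply Finset.card_le_card_of_injOn (fun I => I.erase v)
  · intro I hI
    have hI' := Finset.mem_filter.1 (Finset.mem_coe.1 hI)
    obtain ⟨hM, hv⟩ := hI'
    obtain ⟨hS, hi, hm, hc⟩ := mem_misF.1 hM
    apply Finset.mem_coe.2
    refine mem_misF.2 ⟨?_, ?_, ?_, ?_⟩
    · intro a ha
      obtain ⟨hav, haI⟩ := Finset.mem_erase.1 ha
      refine Finset.mem_filter.2 ⟨hS haI, ?_⟩
      rintro (h | h)
      · exact hav h
      · exact hi v hv a haI h
    · intro a ha b hb
      exact hi a (Finset.mem_of_mem_erase ha) b (Finset.mem_of_mem_erase hb)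
    · intro w hw hwI
      obtain ⟨hwS, hw2⟩ := Finset.mem_filter.1 hw
      push Not at hw2
      have hwI' : w ∉ I := fun h => hwI (Finset.mem_erase.2 ⟨hw2.1, h⟩)
      obtain ⟨u, hu, hadj⟩ := hm w hwS hwI'
      refine ⟨u, Finset.mem_erase.2 ⟨?_, hu⟩, hadj⟩
      rintro rfl
      exact hw2.2 hadj.symm
    · rw [Finset.card_erase_of_mem hv]; omega
  · intro I hI J hJ h
    have h1 := (Finset.mem_filter.1 (Finset.mem_coe.1 hI)).2
    have h2 := (Finset.mem_filter.1 (Finset.mem_coe.1 hJ)).2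
    rw [← Finset.insert_erase h1, ← Finset.insert_erase h2]
    exact congrArg (insert v) h

open Classical in
theorem mis_out {V : Type*} (G : SimpleGraph V) (v : V) (S : Finset V) (k : ℕ) :
    ((misF G S k).filter fun I => ¬ v ∈ I).card ≤ (misF G (S.erase v) k).card := by
  apply Finset.card_le_card
  intro I hI
  obtain ⟨hM, hv⟩ := Finset.mem_filter.1 hI
  obtain ⟨hS, hi, hm, hc⟩ := mem_misF.1 hM
  exact mem_misF.2 ⟨fun a ha => Finset.mem_erase.2 ⟨fun h => hv (h ▸ ha), hS ha⟩, hi,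
    fun w hw => hm w (Finset.mem_of_mem_erase hw), hc⟩

theorem mis_bound {V : Type*} (G : SimpleGraph V) (S : Finset V) : ∀ k : ℕ,
    ((misF G S k).card : ℝ) ≤ (4/3 : ℝ) ^ S.card * (81/64 : ℝ) ^ k := by
  classical
  induction S using Finset.strongInduction with
  | H S ih =>
  intro k
  rcases S.eq_empty_or_nonempty with rfl | hne
  · have h1 : (misF G ∅ k).card ≤ 1 := by
      apply Finset.card_le_one.2
      intro a ha b hb
      rw [Finset.subset_empty.1 (mem_misF.1 ha).1, Finset.subset_empty.1 (mem_misF.1 hb).1]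
    have h2 : (1:ℝ) ≤ (81/64 : ℝ) ^ k := one_le_pow₀ (by norm_num)
    have h3 : ((misF G ∅ k).card : ℝ) ≤ 1 := by exact_mod_cast h1
    simpa using h3.trans h2
  rcases k with _ | k
  · have h0 : misF G S 0 = ∅ := by
      apply Finset.eq_empty_of_forall_notMem
      intro I hI
      obtain ⟨hS, hi, hm, hc⟩ := mem_misF.1 hI
      have : I = ∅ := Finset.card_eq_zero.1 (by omega)
      subst this
      obtain ⟨v, hv⟩ := hne
      obtain ⟨u, hu, _⟩ := hm v hv (by simp)
      simp at hu
    rw [h0]; simp; positivity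
  have hin : ∀ v ∈ S, ∀ d, d ≤ (closedN G v S).card →
      (((misF G S (k+1)).filter fun I => v ∈ I).card : ℝ) ≤
        (4/3 : ℝ) ^ (S.card - d) * (81/64 : ℝ) ^ k := by
    intro v hv d hd
    have hss : restG G v S ⊂ S := by
      refine Finset.ssubset_iff_subset_ne.2 ⟨Finset.filter_subset _ _, fun h => ?_⟩
      have : v ∈ restG G v S := by rw [h]; exact hv
      exact (Finset.mem_filter.1 this).2 (Or.inl rfl)
    have h1 := ih _ hss k
    have h2 : (((misF G S (k+1)).filter fun I => v ∈ I).card : ℝ) ≤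
      (misF G (restG G v S) k).card := by exact_mod_cast mis_in G v S k
    have h3 := card_rest_add G v S
    refine (h2.trans h1).trans ?_
    gcongr
    · norm_num
    · omega
  by_cases hbig : ∃ v ∈ S, 4 ≤ (closedN G v S).card
  · obtain ⟨v, hv, h4⟩ := hbig
    have h1 := hin v hv 4 h4
    have h2 := ih _ (Finset.erase_ssubset hv) (k+1)
    have h3 : (((misF G S (k+1)).filter fun I => ¬ v ∈ I).card : ℝ) ≤
      (misF G (S.erase v) (k+1)).card := by exact_mod_cast mis_out G v S (k+1)
    have h5 : (((misF G S (k+1)).filter fun I => v ∈ I).card : ℝ) +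
      ((misF G S (k+1)).filter fun I => ¬ v ∈ I).card = (misF G S (k+1)).card := by
      exact_mod_cast Finset.card_filter_add_card_filter_not _
    have h6 := card_rest_add G v S
    rw [Finset.card_erase_of_mem hv] at h2
    obtain ⟨m, hm⟩ : ∃ m, S.card = m + 4 := ⟨S.card - 4, by omega⟩
    rw [hm] at h1 h2 ⊢
    rw [show m + 4 - 4 = m by omega] at h1
    rw [show m + 4 - 1 = m + 3 by omega] at h2
    rw [← h5]
    calc _ ≤ (4/3 : ℝ) ^ m * (81/64 : ℝ) ^ k + (4/3 : ℝ) ^ (m+3) * (81/64 : ℝ) ^ (k+1) :=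
          add_le_add h1 (h3.trans h2)
      _ = _ := by ring
  · push Not at hbig
    obtain ⟨v, hv, hmin⟩ := Finset.exists_min_image S (fun v => (closedN G v S).card) hne
    have hsub : misF G S (k+1) ⊆
        (closedN G v S).biUnion fun u => (misF G S (k+1)).filter fun I => u ∈ I := by
      intro I hI
      obtain ⟨hS, hi, hm, hc⟩ := mem_misF.1 hI
      refine Finset.mem_biUnion.2 ?_
      by_cases hvI : v ∈ I
      · exact ⟨v, Finset.mem_filter.2 ⟨hv, Or.inl rfl⟩, Finset.mem_filter.2 ⟨hI, hvI⟩⟩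
      · obtain ⟨u, hu, hadj⟩ := hm v hv hvI
        exact ⟨u, Finset.mem_filter.2 ⟨hS hu, Or.inr hadj⟩, Finset.mem_filter.2 ⟨hI, hu⟩⟩
    have h1 : ((misF G S (k+1)).card : ℝ) ≤
        ∑ u ∈ closedN G v S, (((misF G S (k+1)).filter fun I => u ∈ I).card : ℝ) := by
      exact_mod_cast (Finset.card_le_card hsub).trans Finset.card_biUnion_le
    have h2 : ∑ u ∈ closedN G v S, (((misF G S (k+1)).filter fun I => u ∈ I).card : ℝ) ≤
        ∑ u ∈ closedN G v S,
          (4/3 : ℝ) ^ (S.card - (closedN G v S).card) * (81/64 : ℝ) ^ k := by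
      apply Finset.sum_le_sum
      intro u hu
      have huS := (Finset.mem_filter.1 hu).1
      exact hin u huS _ (hmin u huS)
    refine (h1.trans h2).trans ?_
    rw [Finset.sum_const, nsmul_eq_mul]
    have hlt := hbig v hv
    have h6 := card_rest_add G v S
    generalize (closedN G v S).card = d at *
    obtain ⟨m, hm⟩ : ∃ m, S.card = m + d := ⟨S.card - d, by omega⟩
    rw [hm, Nat.add_sub_cancel]
    have hp : (0:ℝ) < (4/3 : ℝ) ^ m * (81/64 : ℝ) ^ k := by positivity
    rw [pow_add, pow_succ]
    have hd : (d:ℝ) ≤ (4/3 : ℝ) ^ d * (81/64) := by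
      interval_cases d <;> norm_num
    calc _ ≤ ((4/3 : ℝ) ^ d * (81/64)) * ((4/3 : ℝ) ^ m * (81/64 : ℝ) ^ k) :=
          mul_le_mul_of_nonneg_right hd hp.le
      _ = _ := by ring

/-- The number of maximal independent sets of cardinality at most `k` in an
`n`-vertex graph is at most `3 ^ (4k - n) * 4 ^ (n - 3k)` (integer exponents,
possibly negative, interpreted in the reals). -/
theorem small_max_indep_sets_bound {V : Type*} [Fintype V] (G : SimpleGraph V) (k : ℕ) :
    (Nat.card {I : Finset V // IsMaxIndepOn G Set.univ I ∧ I.card ≤ k} : ℝ) ≤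
      (3 : ℝ) ^ (4 * (k : ℤ) - (Fintype.card V : ℤ)) *
        (4 : ℝ) ^ ((Fintype.card V : ℤ) - 3 * (k : ℤ)) := by
  classical
  have hb := mis_bound G Finset.univ k
  have hcard : Nat.card {I : Finset V // IsMaxIndepOn G Set.univ I ∧ I.card ≤ k} ≤
      (misF G Finset.univ k).card := by
    have hc0 : Nat.card (↑(misF G Finset.univ k) : Set (Finset V)) =
        (misF G Finset.univ k).card := by simp
    rw [← hc0]
    refine Nat.card_le_card_of_injective
      (fun I => (⟨I.1, Finset.mem_coe.2 ?_⟩ : (↑(misF G Finset.univ k) : Set (Finset V)))) ?_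
    · obtain ⟨I, ⟨_, hi, hmax⟩, hc⟩ := I
      have hi' : ∀ a ∈ I, ∀ b ∈ I, ¬ G.Adj a b := by
        intro a ha b hb h
        exact hi (Finset.mem_coe.2 ha) (Finset.mem_coe.2 hb) h.ne h
      refine mem_misF.2 ⟨Finset.subset_univ _, hi', ?_, hc⟩
      intro v _ hv
      by_contra hcon
      push Not at hcon
      have := hmax (insert v I) (Set.subset_univ _) ?_ (Finset.subset_insert _ _)
      · exact hv (by
          change v ∈ I
          rw [this]
          exact Finset.mem_insert_self v I)
      · intro a ha b hb hab h
        rcases Finset.mem_insert.1 (Finset.mem_coe.1 ha) with rfl | ha'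
        · rcases Finset.mem_insert.1 (Finset.mem_coe.1 hb) with rfl | hb'
          · exact hab rfl
          · exact hcon b hb' h
        · rcases Finset.mem_insert.1 (Finset.mem_coe.1 hb) with rfl | hb'
          · exact hcon a ha' h.symm
          · exact hi' a ha' b hb' h
    · intro I J h
      exact Subtype.ext (congrArg (fun x => x.1) h)
  have heq : (3 : ℝ) ^ (4 * (k : ℤ) - (Fintype.card V : ℤ)) *
        (4 : ℝ) ^ ((Fintype.card V : ℤ) - 3 * (k : ℤ)) =
      (4/3 : ℝ) ^ (Finset.univ : Finset V).card * (81/64 : ℝ) ^ k := by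
    rw [Finset.card_univ, zpow_sub₀ (by norm_num), zpow_sub₀ (by norm_num), zpow_mul, zpow_mul]
    simp only [zpow_natCast]
    rw [div_pow, div_pow, show ((3:ℝ) ^ (4:ℤ)) = 81 by norm_num,
      show ((4:ℝ) ^ (3:ℤ)) = 64 by norm_num]
    field_simp
  rw [heq]
  exact (by exact_mod_cast hcard : (_ : ℝ) ≤ ((misF G Finset.univ k).card : ℝ)).trans hb
end

section
/- Let G be a finite simple graph, let k ≥ 1 be an integer, and let M be a maximal (k+1)-chromatic subset of V(G). Let (S, I) be a partition of M such that the subgraph of G induced by S has chromatic number k, I is an independent set of G, and |S| is maximum among all such partitions of M. Then: (1) I is a maximal independent set of the subgraph of G induced by V(G) \ S; (2) k · |I| ≤ |S|; and (3) S is a maximal k-chromatic subset of V(G). -/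
/-- The chromatic number of the subgraph of `G` induced by the vertex set `A`. -/
noncomputable def chrNum {V : Type*} (G : SimpleGraph V) (A : Finset V) : ℕ∞ :=
  (G.induce (A : Set V)).chromaticNumber

/-- `S` is a maximal `k`-chromatic subset of `T`: `S ⊆ T`, the subgraph induced by `S`
is `k`-chromatic, and every `S'` with `S ⊊ S' ⊆ T` induces a subgraph of chromatic
number greater than `k`. -/
def IsMaxChromaticSubset {V : Type*} (G : SimpleGraph V) (k : ℕ) (S T : Finset V) : Prop :=
  S ⊆ T ∧ chrNum G S = (k : ℕ∞) ∧
    ∀ S' : Finset V, S ⊂ S' → S' ⊆ T → (k : ℕ∞) < chrNum G S'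

/-- `A` is properly `n`-colourable, phrased with a total colouring function. -/
def Col {V : Type*} (G : SimpleGraph V) (A : Finset V) (n : ℕ) : Prop :=
  ∃ f : V → ℕ, (∀ v ∈ A, f v < n) ∧ ∀ u ∈ A, ∀ v ∈ A, G.Adj u v → f u ≠ f v

theorem chrNum_le_iff {V : Type*} [DecidableEq V] (G : SimpleGraph V) (A : Finset V) (n : ℕ) :
    chrNum G A ≤ (n : ℕ∞) ↔ Col G A n := by
  unfold chrNum
  rw [SimpleGraph.chromaticNumber_le_iff_colorable]
  constructor
  · rintro ⟨c⟩
    refine ⟨fun v => if h : v ∈ A then (c ⟨v, by simpa using h⟩ : ℕ) else 0, ?_, ?_⟩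
    · intro v hv
      simp [hv]
    · intro u hu v hv huv
      simp only [hu, hv, dif_pos]
      intro h
      exact c.valid (v := ⟨u, by simpa using hu⟩) (w := ⟨v, by simpa using hv⟩)
        (by simpa using huv) (Fin.ext h)
  · rintro ⟨f, h1, h2⟩
    refine ⟨SimpleGraph.Coloring.mk (fun v => ⟨f v.1, h1 v.1 (by simpa using v.2)⟩) ?_⟩
    intro u v huv h
    exact h2 u.1 (by simpa using u.2) v.1 (by simpa using v.2) (by simpa using huv)
      (by simpa using h)

theorem Col.union {V : Type*} [DecidableEq V] {G : SimpleGraph V} {A B : Finset V} {n : ℕ}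
    (h : Col G A n) (hB : IsIndep G B) : Col G (A ∪ B) (n + 1) := by
  obtain ⟨f, h1, h2⟩ := h
  refine ⟨fun v => if v ∈ A then f v else n, ?_, ?_⟩
  · intro v _
    by_cases hv : v ∈ A
    · have := h1 v hv
      simp only [hv, if_true]
      omega
    · simp [hv]
  · intro u hu v hv huv
    by_cases hu' : u ∈ A <;> by_cases hv' : v ∈ A <;> simp only [hu', hv', if_true, if_false]
    · exact h2 u hu' v hv' huv
    · exact (h1 u hu').ne
    · exact (h1 v hv').ne'
    · have hu2 : u ∈ B := by simpa [hu'] using hu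
      have hv2 : v ∈ B := by simpa [hv'] using hv
      exact absurd huv (hB (by simpa using hu2) (by simpa using hv2) huv.ne)

theorem chrNum_eq_of_part {V : Type*} [DecidableEq V] {G : SimpleGraph V} {M P Q : Finset V}
    {k : ℕ} (hM : chrNum G M = ((k + 1 : ℕ) : ℕ∞)) (hPQ : P ∪ Q = M) (hQ : IsIndep G Q)
    (hP : Col G P k) : chrNum G P = (k : ℕ∞) := by
  have hle := (chrNum_le_iff G P k).2 hP
  obtain ⟨m, hm⟩ := ENat.ne_top_iff_exists.1 (ne_top_of_le_ne_top (ENat.coe_ne_top k) hle)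
  have h1 := ((chrNum_le_iff G P m).1 hm.ge).union hQ
  rw [hPQ, ← chrNum_le_iff, hM] at h1
  rw [← hm] at hle ⊢
  norm_cast at *
  omega

/-- If `M` is a maximal `(k+1)`-chromatic subset of `V(G)` and `(S, I)` is a partition
of `M` into a `k`-chromatic set `S` and an independent set `I` maximizing `|S|`, then
`I` is a maximal independent set of the subgraph induced by `V(G) \ S`,
`k * |I| ≤ |S|`, and `S` is a maximal `k`-chromatic subset of `V(G)`. -/
theorem partition_of_max_chromatic {V : Type*} [Fintype V] [DecidableEq V]
    (G : SimpleGraph V) (k : ℕ) (hk : 1 ≤ k) (M S I : Finset V)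
    (hM : IsMaxChromaticSubset G (k + 1) M Finset.univ)
    (hunion : S ∪ I = M) (hdisj : Disjoint S I)
    (hS : chrNum G S = (k : ℕ∞)) (hI : IsIndep G I)
    (hmax : ∀ S' I' : Finset V, S' ∪ I' = M → Disjoint S' I' →
      chrNum G S' = (k : ℕ∞) → IsIndep G I' → S'.card ≤ S.card) :
    IsMaxIndepOn G ((↑S : Set V)ᶜ) I ∧ k * I.card ≤ S.card ∧
      IsMaxChromaticSubset G k S Finset.univ := by
  obtain ⟨-, hMc, hMm⟩ := hM
  have hSk : Col G S k := (chrNum_le_iff G S k).1 hS.le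
  have key : ∀ A : Finset V, M ⊆ A → Col G A (k + 1) → M = A := by
    intro A hA hc
    by_contra hne
    exact absurd ((chrNum_le_iff G A (k + 1)).2 hc)
      (not_le.2 (hMm A (Finset.ssubset_iff_subset_ne.2 ⟨hA, hne⟩) (Finset.subset_univ _)))
  refine ⟨⟨?_, hI, ?_⟩, ?_, Finset.subset_univ _, hS, ?_⟩
  · intro v hv hvS
    exact Finset.disjoint_left.1 hdisj (by simpa using hvS) (by simpa using hv)
  · intro J hJ hJi hIJ
    have h := key (S ∪ J) (hunion ▸ Finset.union_subset_union_right hIJ) (hSk.union hJi)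
    refine Finset.Subset.antisymm hIJ fun v hv => ?_
    have hvM : v ∈ S ∪ I := by
      rw [hunion, h]
      exact Finset.mem_union_right _ hv
    have hvS : v ∉ S := fun hs => hJ (by simpa using hv) (by simpa using hs)
    simpa [hvS] using hvM
  · obtain ⟨f, h1, h2⟩ := hSk
    have hc : ∀ c ∈ Finset.range k, I.card ≤ (S.filter fun v => f v = c).card := by
      intro c hck
      rw [Finset.mem_range] at hck
      have hU : ((S.filter fun v => ¬ f v = c) ∪ I) ∪ (S.filter fun v => f v = c) = M := by
        rw [← hunion]
        ext v
        simp only [Finset.mem_union, Finset.mem_filter]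
        tauto
      have hD : Disjoint ((S.filter fun v => ¬ f v = c) ∪ I) (S.filter fun v => f v = c) := by
        rw [Finset.disjoint_left] at hdisj ⊢
        intro v
        have := @hdisj v
        simp only [Finset.mem_union, Finset.mem_filter]
        tauto
      have hind : IsIndep G (S.filter fun v => f v = c) := by
        intro u hu v hv _ huv
        simp only [Finset.coe_filter, Set.mem_setOf_eq] at hu hv
        exact h2 u hu.1 v hv.1 huv (hu.2.trans hv.2.symm)
      have hcol : Col G ((S.filter fun v => ¬ f v = c) ∪ I) k := by
        refine ⟨fun v => if v ∈ I then c else f v, ?_, ?_⟩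
        · intro v hv
          by_cases hvI : v ∈ I
          · simpa [hvI] using hck
          · simp only [Finset.mem_union, Finset.mem_filter, hvI, or_false] at hv
            simpa [hvI] using h1 v hv.1
        · intro u hu v hv huv
          simp only [Finset.mem_union, Finset.mem_filter] at hu hv
          by_cases hu' : u ∈ I <;> by_cases hv' : v ∈ I <;>
            simp only [hu', hv', if_true, if_false, or_false] at hu hv ⊢
          · exact absurd huv (hI (by simpa using hu') (by simpa using hv') huv.ne)
          · exact fun h => hv.2 h.symm
          · exact hu.2
          · exact h2 u hu.1 v hv.1 huv
      have hle := hmax _ _ hU hD (chrNum_eq_of_part hMc hU hind hcol) hind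
      rw [Finset.card_union_of_disjoint
        (Finset.disjoint_of_subset_left (Finset.filter_subset _ _) hdisj)] at hle
      have := Finset.card_filter_add_card_filter_not (s := S) (fun v => f v = c)
      omega
    calc k * I.card = ∑ _c ∈ Finset.range k, I.card := by simp
      _ ≤ ∑ c ∈ Finset.range k, (S.filter fun v => f v = c).card := Finset.sum_le_sum hc
      _ = S.card := (Finset.card_eq_sum_card_fiberwise
          (fun v hv => by simpa using h1 v (by simpa using hv))).symm
  · intro S' hSS' _
    by_contra hlt
    have hcol := (chrNum_le_iff G S' k).1 (not_lt.1 hlt)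
    have hI' : IsIndep G (I \ S') := fun u hu v hv =>
      hI (by simp at hu ⊢; exact hu.1) (by simp at hv ⊢; exact hv.1)
    have hU : M = S' ∪ (I \ S') := by
      refine key _ ?_ (hcol.union hI')
      rw [← hunion, Finset.union_sdiff_self_eq_union]
      exact Finset.union_subset_union_left hSS'.subset
    have := hmax S' (I \ S') hU.symm Finset.disjoint_sdiff
      (chrNum_eq_of_part hMc hU.symm hI' hcol) hI'
    exact absurd (Finset.card_lt_card hSS') (not_lt.2 this)
end

section
/- Let G be a finite simple graph, let v be a vertex of G, and let I be a maximal independent set of G. If v ∈ I, then I \ {v} is a maximal independent set of the subgraph of G induced by V(G) \ N[v], where N[v] is the closed neighborhood of v. If v ∉ I, then I is a maximal independent set of the subgraph of G induced by V(G) \ {v}. -/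
/-- For a maximal independent set `I` of `G` and a vertex `v`: if `v ∈ I`, then
`I \ {v}` is a maximal independent set of the subgraph induced by `V(G) \ N[v]`;
if `v ∉ I`, then `I` is a maximal independent set of the subgraph induced by
`V(G) \ {v}`. -/
theorem max_indep_vertex_cases {V : Type*} [Fintype V] [DecidableEq V]
    (G : SimpleGraph V) (v : V) (I : Finset V)
    (hI : IsMaxIndepOn G Set.univ I) :
    (v ∈ I → IsMaxIndepOn G ((insert v (G.neighborSet v))ᶜ) (I.erase v)) ∧
    (v ∉ I → IsMaxIndepOn G ({v}ᶜ : Set V) I) := by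
  obtain ⟨-, hind, hmax⟩ := hI
  refine ⟨fun hv => ⟨?_, ?_, ?_⟩, fun hv => ⟨?_, hind, ?_⟩⟩
  · intro x hx
    have hx' := Finset.mem_erase.1 (Finset.mem_coe.1 hx)
    rintro (h | h)
    · exact hx'.1 h
    · exact hind (Finset.mem_coe.2 hv) (Finset.mem_coe.2 hx'.2) (Ne.symm hx'.1) h
  · intro a ha b hb hab
    exact hind (Finset.mem_coe.2 (Finset.mem_of_mem_erase (Finset.mem_coe.1 ha)))
      (Finset.mem_coe.2 (Finset.mem_of_mem_erase (Finset.mem_coe.1 hb))) hab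
  · intro J hJ hJi hsub
    have hvJ : v ∉ J := fun h => hJ (Finset.mem_coe.2 h) (Or.inl rfl)
    have hadj : ∀ x ∈ J, ¬ G.Adj v x := fun x hx h => hJ (Finset.mem_coe.2 hx) (Or.inr h)
    have key : I = insert v J := by
      apply hmax _ (Set.subset_univ _)
      · intro a ha b hb hab
        rcases Finset.mem_insert.1 (Finset.mem_coe.1 ha) with rfl | ha'
        · rcases Finset.mem_insert.1 (Finset.mem_coe.1 hb) with rfl | hb'
          · exact absurd rfl hab
          · exact hadj b hb'
        · rcases Finset.mem_insert.1 (Finset.mem_coe.1 hb) with rfl | hb'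
          · exact fun h => hadj a ha' h.symm
          · exact hJi (Finset.mem_coe.2 ha') (Finset.mem_coe.2 hb') hab
      · exact Finset.subset_insert_iff.2 hsub
    rw [key, Finset.erase_insert hvJ]
  · intro x hx h
    have h' : x = v := h
    exact hv (h' ▸ Finset.mem_coe.1 hx)
  · intro J _ hJi hsub
    exact hmax J (Set.subset_univ _) hJi hsub
end

section
/- Let G be a finite simple graph, let v be a vertex of G, and let k be a nonnegative integer. Then the number of maximal independent sets I of G with |I| ≤ k is at most the number of maximal independent sets of cardinality at most k of the subgraph of G induced by V(G) \ {v}, plus the number of maximal independent sets of cardinality at most k − 1 of the subgraph of G induced by V(G) \ N[v] (this second term being 0 when k = 0). -/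
/-- The number of maximal independent sets of `G` of cardinality at most `k` is at most
the number of maximal independent sets of cardinality at most `k` of the subgraph
induced by `V(G) \ {v}`, plus the number of maximal independent sets of cardinality at
most `k - 1` of the subgraph induced by `V(G) \ N[v]` (the condition `|I| + 1 ≤ k`
makes this second term `0` when `k = 0`). -/
theorem max_indep_count_split {V : Type*} [Fintype V] [DecidableEq V]
    (G : SimpleGraph V) (v : V) (k : ℕ) :
    Nat.card {I : Finset V // IsMaxIndepOn G Set.univ I ∧ I.card ≤ k} ≤
      Nat.card {I : Finset V // IsMaxIndepOn G ({v}ᶜ : Set V) I ∧ I.card ≤ k} +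
      Nat.card {I : Finset V //
        IsMaxIndepOn G ((insert v (G.neighborSet v))ᶜ) I ∧ I.card + 1 ≤ k} := by
  classical
  have h1 : ∀ I : Finset V, IsMaxIndepOn G Set.univ I → v ∉ I →
      IsMaxIndepOn G ({v}ᶜ : Set V) I := by
    rintro I ⟨_, hI, hm⟩ hv
    refine ⟨?_, hI, fun J _ hJ hIJ => hm J (Set.subset_univ _) hJ hIJ⟩
    intro x hx hxv
    rw [Set.mem_singleton_iff] at hxv
    subst hxv
    exact hv hx
  have h2 : ∀ I : Finset V, IsMaxIndepOn G Set.univ I → v ∈ I →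
      IsMaxIndepOn G ((insert v (G.neighborSet v))ᶜ) (I.erase v) := by
    rintro I ⟨_, hI, hm⟩ hv
    refine ⟨?_, ?_, ?_⟩
    · intro x hx hxv
      have hx' := Finset.mem_erase.1 (Finset.mem_coe.1 hx)
      rcases hxv with h | h
      · exact hx'.1 h
      · exact hI (Finset.mem_coe.2 hv) (Finset.mem_coe.2 hx'.2) (Ne.symm hx'.1) h
    · intro a ha b hb hab
      exact hI (Finset.mem_coe.2 (Finset.mem_of_mem_erase (Finset.mem_coe.1 ha)))
        (Finset.mem_coe.2 (Finset.mem_of_mem_erase (Finset.mem_coe.1 hb))) hab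
    · intro J hJA hJ hIJ
      have hvJ : v ∉ J := fun h => hJA (Finset.mem_coe.2 h) (Or.inl rfl)
      have hnot : ∀ b ∈ J, ¬ G.Adj v b := fun b hb h =>
        hJA (Finset.mem_coe.2 hb) (Or.inr h)
      have key : I = insert v J := by
        apply hm _ (Set.subset_univ _)
        · intro a ha b hb hab hadj
          rcases Finset.mem_insert.1 (Finset.mem_coe.1 ha) with rfl | ha2
          · rcases Finset.mem_insert.1 (Finset.mem_coe.1 hb) with rfl | hb2
            · exact hab rfl
            · exact hnot b hb2 hadj
          · rcases Finset.mem_insert.1 (Finset.mem_coe.1 hb) with rfl | hb2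
            · exact hnot a ha2 hadj.symm
            · exact hJ (Finset.mem_coe.2 ha2) (Finset.mem_coe.2 hb2) hab hadj
        · exact Finset.subset_insert_iff.2 hIJ
      rw [key, Finset.erase_insert hvJ]
  rw [← Nat.card_sum]
  refine Nat.card_le_card_of_injective (fun I =>
    if hv : v ∈ I.1 then
      Sum.inr ⟨I.1.erase v, h2 I.1 I.2.1 hv, by
        rw [Finset.card_erase_add_one hv]; exact I.2.2⟩
    else Sum.inl ⟨I.1, h1 I.1 I.2.1 hv, I.2.2⟩) ?_
  rintro ⟨I, hI⟩ ⟨J, hJ⟩ h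
  apply Subtype.ext
  by_cases hvI : v ∈ I <;> by_cases hvJ : v ∈ J <;> simp [hvI, hvJ] at h
  · show I = J
    rw [← Finset.insert_erase hvI, h, Finset.insert_erase hvJ]
  · exact h
end

section
/- Let m be a nonnegative integer and let G be the graph on 3m vertices formed by the disjoint union of m triangles (copies of K₃). Then G has exactly 3^m maximal independent sets, and every maximal independent set of G has cardinality exactly m. -/
/-- `I` is a maximal independent set of `G`. -/
def IsMaxIndep {V : Type*} (G : SimpleGraph V) (I : Finset V) : Prop :=
  IsIndep G I ∧ ∀ J : Finset V, IsIndep G J → I ⊆ J → I = J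

/-- The disjoint union of `m` triangles (copies of `K₃`): two distinct vertices
are adjacent iff they lie in the same triangle. -/
def triangles (m : ℕ) : SimpleGraph (Fin m × Fin 3) :=
  SimpleGraph.fromRel fun x y => x.1 = y.1

theorem triangles_adj {m : ℕ} (x y : Fin m × Fin 3) :
    (triangles m).Adj x y ↔ x ≠ y ∧ x.1 = y.1 := by
  simp only [triangles, SimpleGraph.fromRel_adj]
  constructor
  · rintro ⟨h, h1 | h1⟩
    · exact ⟨h, h1⟩
    · exact ⟨h, h1.symm⟩
  · rintro ⟨h, h1⟩
    exact ⟨h, Or.inl h1⟩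

/-- The transversal given by choosing one vertex in each triangle. -/
def transversal {m : ℕ} (f : Fin m → Fin 3) : Finset (Fin m × Fin 3) :=
  Finset.univ.image fun i => (i, f i)

theorem mem_transversal {m : ℕ} (f : Fin m → Fin 3) (x : Fin m × Fin 3) :
    x ∈ transversal f ↔ x.2 = f x.1 := by
  obtain ⟨a, b⟩ := x
  simp only [transversal, Finset.mem_image, Finset.mem_univ, true_and, Prod.mk.injEq]
  constructor
  · rintro ⟨i, rfl, rfl⟩
    rfl
  · intro h
    exact ⟨a, rfl, h.symm⟩

theorem isIndep_triangles_iff {m : ℕ} (I : Finset (Fin m × Fin 3)) :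
    IsIndep (triangles m) I ↔ ∀ x ∈ I, ∀ y ∈ I, x.1 = y.1 → x = y := by
  constructor
  · intro h x hx y hy hxy
    by_contra hne
    exact h hx hy hne ((triangles_adj x y).2 ⟨hne, hxy⟩)
  · intro h x hx y hy hne hadj
    exact hne (h x hx y hy ((triangles_adj x y).1 hadj).2)

theorem transversal_isMaxIndep {m : ℕ} (f : Fin m → Fin 3) :
    IsMaxIndep (triangles m) (transversal f) := by
  refine ⟨?_, ?_⟩
  · rw [isIndep_triangles_iff]
    intro x hx y hy hxy
    rw [mem_transversal] at hx hy
    exact Prod.ext hxy (by rw [hx, hy, hxy])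
  · intro J hJ hsub
    rw [isIndep_triangles_iff] at hJ
    refine Finset.Subset.antisymm hsub fun x hx => ?_
    have h1 : (x.1, f x.1) ∈ transversal f := (mem_transversal _ _).2 rfl
    rw [hJ x hx _ (hsub h1) rfl]
    exact h1

theorem exists_transversal {m : ℕ} {I : Finset (Fin m × Fin 3)}
    (hI : IsMaxIndep (triangles m) I) : ∃ f, transversal f = I := by
  have hind := (isIndep_triangles_iff I).1 hI.1
  have key : ∀ i : Fin m, ∃ c : Fin 3, (i, c) ∈ I := by
    intro i
    by_contra! hno
    have hJ : IsIndep (triangles m) (insert (i, 0) I) := by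
      rw [isIndep_triangles_iff]
      intro x hx y hy hxy
      rw [Finset.mem_insert] at hx hy
      rcases hx with rfl | hx <;> rcases hy with rfl | hy
      · rfl
      · obtain ⟨a, b⟩ := y
        obtain rfl : i = a := hxy
        exact absurd hy (hno b)
      · obtain ⟨a, b⟩ := x
        obtain rfl : a = i := hxy
        exact absurd hx (hno b)
      · exact hind x hx y hy hxy
    have heq := hI.2 _ hJ (Finset.subset_insert _ _)
    apply hno 0
    rw [heq]
    exact Finset.mem_insert_self _ _
  choose f hf using key
  refine ⟨f, (transversal_isMaxIndep f).2 I hI.1 fun x hx => ?_⟩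
  obtain ⟨a, b⟩ := x
  obtain rfl : b = f a := (mem_transversal f _).1 hx
  exact hf a

theorem transversal_injective {m : ℕ} :
    Function.Injective (transversal : (Fin m → Fin 3) → Finset (Fin m × Fin 3)) := by
  intro f g h
  funext i
  have h1 : (i, f i) ∈ transversal f := (mem_transversal _ _).2 rfl
  rw [h] at h1
  exact (mem_transversal g _).1 h1

/-- The disjoint union of `m` triangles has exactly `3 ^ m` maximal independent sets,
and every maximal independent set has cardinality exactly `m`. -/
theorem triangles_max_indep_count (m : ℕ) :
    Nat.card {I : Finset (Fin m × Fin 3) // IsMaxIndep (triangles m) I} = 3 ^ m ∧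
    ∀ I : Finset (Fin m × Fin 3), IsMaxIndep (triangles m) I → I.card = m := by
  refine ⟨?_, ?_⟩
  · have hb : Function.Bijective (fun f : Fin m → Fin 3 =>
        (⟨transversal f, transversal_isMaxIndep f⟩ :
          {I : Finset (Fin m × Fin 3) // IsMaxIndep (triangles m) I})) := by
      refine ⟨fun f g h => transversal_injective (congrArg Subtype.val h), fun I => ?_⟩
      obtain ⟨f, hf⟩ := exists_transversal I.2
      exact ⟨f, Subtype.ext hf⟩
    rw [← Nat.card_eq_of_bijective _ hb]
    simp
  · intro I hI
    obtain ⟨f, rfl⟩ := exists_transversal hI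
    rw [transversal, Finset.card_image_of_injective _ fun i j h => congrArg Prod.fst h]
    simp
end
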